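/- Let E be a standard Borel (Polish) space, N ≥ 1, and let P be a probability measure on E^N that is exchangeable, i.e. invariant under the pushforward by every permutation of the N coordinates. Let ν be a probability measure on E, and for 1 ≤ k ≤ N let P_k denote the pushforward of P under the projection of E^N onto the first k coordinates. Then (1/k) · H(P_k | ν^{⊗k}) ≤ (1/N) · H(P | ν^{⊗N}), where ν^{⊗j} denotes the j-fold product measure. -/

import Mathlib

open MeasureTheory
open scoped Classical

/-- The relative entropy (Kullback–Leibler divergence) `H(P|Q) = ∫ log (dP/dQ) dP` when
`P ≪ Q` (and the integral exists), and `+∞` otherwise. -/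
noncomputable def relEntropy {α : Type*} [MeasurableSpace α] (P Q : Measure α) : ENNReal :=
  if P ≪ Q ∧ Integrable (fun x => Real.log (P.rnDeriv Q x).toReal) P then
    ENNReal.ofReal (∫ x, Real.log (P.rnDeriv Q x).toReal ∂P)
  else ⊤

open InformationTheory ProbabilityTheory
open scoped ENNReal

theorem relEntropy_eq_klDiv {α : Type*} [MeasurableSpace α] (P Q : Measure α)
    [IsProbabilityMeasure P] [IsProbabilityMeasure Q] : relEntropy P Q = klDiv P Q := by
  rw [relEntropy, klDiv]
  simp [llr_def]

theorem klDiv_map_measurableEquiv {α β : Type*} [MeasurableSpace α] [MeasurableSpace β]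
    (P Q : Measure α) [IsFiniteMeasure P] [IsFiniteMeasure Q] (e : α ≃ᵐ β) :
    klDiv (P.map e) (Q.map e) = klDiv P Q := by
  refine le_antisymm (klDiv_map_le _ _ e.measurable) ?_
  simpa using klDiv_map_le (P.map e) (Q.map e) e.symm.measurable

/-- Chain rule for the relative entropy with respect to a product measure. -/
theorem klDiv_prod_eq_add {α E : Type*} [MeasurableSpace α] [MeasurableSpace E]
    [StandardBorelSpace E] (Q : Measure (α × E)) [IsProbabilityMeasure Q]
    (μ : Measure α) [IsProbabilityMeasure μ] (ν : Measure E) [IsProbabilityMeasure ν] :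
    klDiv Q (μ.prod ν) = klDiv Q.fst μ + klDiv Q (Q.fst.prod ν) := by
  have : Nonempty E := ν.nonempty_of_neZero
  have h := klDiv_compProd_eq_add Q.fst μ Q.condKernel (Kernel.const α ν)
  rwa [Measure.disintegrate, Measure.compProd_const, Measure.compProd_const] at h

section Exchangeable

variable {E : Type*} [MeasurableSpace E]

/-- A law on `E ^ n` is exchangeable if it is invariant under permutations of coordinates. -/
def IsExchangeable {n : ℕ} (P : Measure (Fin n → E)) : Prop :=
  ∀ σ : Equiv.Perm (Fin n), P.map (fun x => x ∘ σ) = P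

/-- The law of all coordinates but the last one. -/
noncomputable def initLaw {n : ℕ} (P : Measure (Fin (n + 1) → E)) : Measure (Fin n → E) :=
  P.map (fun x i => x i.castSucc)

/-- Splitting off the last coordinate. -/
def splitLast (n : ℕ) : (Fin (n + 1) → E) ≃ᵐ (Fin n → E) × E :=
  (MeasurableEquiv.piFinSuccAbove (fun _ => E) (Fin.last n)).trans MeasurableEquiv.prodComm

theorem coe_splitLast (n : ℕ) : ⇑(splitLast n : (Fin (n + 1) → E) ≃ᵐ (Fin n → E) × E) =
    fun x => (fun i => x i.castSucc, x (Fin.last n)) := by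
  ext x i
  · simp [splitLast, MeasurableEquiv.piFinSuccAbove, Fin.insertNthEquiv, Fin.init,
      MeasurableEquiv.prodComm]
  · simp [splitLast, MeasurableEquiv.piFinSuccAbove, Fin.insertNthEquiv,
      MeasurableEquiv.prodComm]

theorem map_splitLast_pi (n : ℕ) (ν : Measure E) [IsProbabilityMeasure ν] :
    (Measure.pi fun _ : Fin (n + 1) => ν).map (splitLast n) =
      (Measure.pi fun _ : Fin n => ν).prod ν :=
  (Measure.measurePreserving_swap.comp
    (measurePreserving_piFinSuccAbove (fun _ : Fin (n + 1) => ν) (Fin.last n))).map_eq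

instance {n : ℕ} (P : Measure (Fin (n + 1) → E)) [IsProbabilityMeasure P] :
    IsProbabilityMeasure (initLaw P) :=
  Measure.isProbabilityMeasure_map (Measurable.aemeasurable (by fun_prop))

instance {n : ℕ} (P : Measure (Fin (n + 1) → E)) [IsProbabilityMeasure P] :
    IsProbabilityMeasure (P.map (splitLast n)) :=
  Measure.isProbabilityMeasure_map (splitLast n).measurable.aemeasurable

theorem fst_map_splitLast {n : ℕ} (P : Measure (Fin (n + 1) → E)) :
    (P.map (splitLast n)).fst = initLaw P := by
  rw [Measure.fst, Measure.map_map measurable_fst (splitLast n).measurable, coe_splitLast]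
  rfl

theorem IsExchangeable.isExchangeable_initLaw {n : ℕ} {P : Measure (Fin (n + 1) → E)}
    (hP : IsExchangeable P) : IsExchangeable (initLaw P) := by
  intro σ
  let τ : Equiv.Perm (Fin (n + 1)) := σ.viaFintypeEmbedding Fin.castSuccEmb
  have hτ (i : Fin n) : τ i.castSucc = (σ i).castSucc :=
    σ.viaFintypeEmbedding_apply_image Fin.castSuccEmb i
  conv_rhs => rw [initLaw, ← hP τ]
  rw [initLaw, Measure.map_map (by fun_prop) (by fun_prop),
    Measure.map_map (by fun_prop) (by fun_prop)]
  congr 1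
  ext x i
  simp [hτ]

/-- The conditional relative entropy of the last coordinate given the others, relative to `ν`. -/
noncomputable def lastEntropy {n : ℕ} (P : Measure (Fin (n + 1) → E)) (ν : Measure E) : ℝ≥0∞ :=
  klDiv (P.map (splitLast n)) ((initLaw P).prod ν)

theorem klDiv_pi_succ [StandardBorelSpace E] {n : ℕ} (P : Measure (Fin (n + 1) → E))
    [IsProbabilityMeasure P] (ν : Measure E) [IsProbabilityMeasure ν] :
    klDiv P (Measure.pi fun _ => ν) =
      klDiv (initLaw P) (Measure.pi fun _ => ν) + lastEntropy P ν := by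
  rw [← klDiv_map_measurableEquiv P _ (splitLast n), map_splitLast_pi, klDiv_prod_eq_add,
    fst_map_splitLast, lastEntropy]

/-- Conditioning on more coordinates increases the conditional relative entropy. -/
theorem IsExchangeable.lastEntropy_initLaw_le {n : ℕ} {P : Measure (Fin (n + 2) → E)}
    [IsProbabilityMeasure P] (hP : IsExchangeable P) (ν : Measure E) [IsProbabilityMeasure ν] :
    lastEntropy (initLaw P) ν ≤ lastEntropy P ν := by
  let f : (Fin (n + 1) → E) → (Fin n → E) := fun x i => x i.castSucc
  have hf : Measurable f := by fun_prop
  have hprod : ((initLaw P).prod ν).map (Prod.map f id) =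
      (initLaw (initLaw P)).prod ν := by
    rw [← Measure.map_prod_map _ _ hf measurable_id, Measure.map_id]
    rfl
  have hmap : (P.map (splitLast (n + 1))).map (Prod.map f id) =
      (initLaw P).map (splitLast n) := by
    let σ : Equiv.Perm (Fin (n + 2)) := Equiv.swap (Fin.last n).castSucc (Fin.last (n + 1))
    conv_rhs => rw [initLaw, ← hP σ]
    rw [Measure.map_map (by fun_prop) (by fun_prop),
      Measure.map_map (by fun_prop) (by fun_prop), Measure.map_map (by fun_prop) (by fun_prop),
      coe_splitLast, coe_splitLast]
    congr 1
    ext x i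
    · have h : σ i.castSucc.castSucc = i.castSucc.castSucc :=
        Equiv.swap_apply_of_ne_of_ne (by simp [Fin.ext_iff]; omega) (by simp [Fin.ext_iff]; omega)
      simp [f, h]
    · simp [σ]
  rw [lastEntropy, lastEntropy, ← hprod, ← hmap]
  exact klDiv_map_le _ _ (by fun_prop)

theorem IsExchangeable.klDiv_initLaw_le_mul_lastEntropy [StandardBorelSpace E] (ν : Measure E)
    [IsProbabilityMeasure ν] {n : ℕ} {P : Measure (Fin (n + 1) → E)} [IsProbabilityMeasure P]
    (hP : IsExchangeable P) :
    klDiv (initLaw P) (Measure.pi fun _ => ν) ≤ n * lastEntropy P ν := by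
  induction n with
  | zero =>
    have h : initLaw P = Measure.pi fun _ => ν := by
      ext s -
      induction s using Subsingleton.set_cases <;> simp
    simp [h, klDiv_self]
  | succ n ih =>
    calc klDiv (initLaw P) (Measure.pi fun _ => ν)
        ≤ n * lastEntropy (initLaw P) ν + lastEntropy (initLaw P) ν := by
          rw [klDiv_pi_succ]
          gcongr
          exact ih hP.isExchangeable_initLaw
      _ = (n + 1 : ℕ) * lastEntropy (initLaw P) ν := by push_cast; ring
      _ ≤ (n + 1 : ℕ) * lastEntropy P ν := by
          gcongr
          exact hP.lastEntropy_initLaw_le ν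

theorem IsExchangeable.klDiv_initLaw_div_le [StandardBorelSpace E] (ν : Measure E)
    [IsProbabilityMeasure ν] {n : ℕ} {P : Measure (Fin (n + 1) → E)}
    [IsProbabilityMeasure P] (hP : IsExchangeable P) :
    klDiv (initLaw P) (Measure.pi fun _ => ν) / n ≤
      klDiv P (Measure.pi fun _ => ν) / (n + 1 : ℕ) := by
  rw [ENNReal.le_div_iff_mul_le (by simp) (by simp), mul_comm, ← mul_div_assoc]
  refine ENNReal.div_le_of_le_mul ?_
  rw [klDiv_pi_succ P]
  have h := hP.klDiv_initLaw_le_mul_lastEntropy ν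
  calc ((n + 1 : ℕ) : ℝ≥0∞) * klDiv (initLaw P) (Measure.pi fun _ => ν)
      = klDiv (initLaw P) (Measure.pi fun _ => ν) * n +
          klDiv (initLaw P) (Measure.pi fun _ => ν) := by push_cast; ring
    _ ≤ klDiv (initLaw P) (Measure.pi fun _ => ν) * n + n * lastEntropy P ν := by gcongr
    _ = _ := by ring

end Exchangeable

/-- Super-additivity of the renormalized relative entropy with respect to a product reference
measure, for exchangeable laws: `(1/k) H(P_k | ν^⊗k) ≤ (1/N) H(P | ν^⊗N)`. -/
theorem statement7 {E : Type*} [MeasurableSpace E] [StandardBorelSpace E]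
    (N : ℕ) (hN : 1 ≤ N) (P : Measure (Fin N → E)) [IsProbabilityMeasure P]
    (hexch : ∀ σ : Equiv.Perm (Fin N),
      Measure.map (fun x : Fin N → E => x ∘ σ) P = P)
    (ν : Measure E) [IsProbabilityMeasure ν]
    (k : ℕ) (hk1 : 1 ≤ k) (hkN : k ≤ N) :
    relEntropy (Measure.map (fun (x : Fin N → E) (i : Fin k) => x (Fin.castLE hkN i)) P)
        (Measure.pi fun _ : Fin k => ν) / (k : ENNReal)
      ≤ relEntropy P (Measure.pi fun _ : Fin N => ν) / (N : ENNReal) := by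
  have : IsProbabilityMeasure
      (P.map (fun (x : Fin N → E) (i : Fin k) => x (Fin.castLE hkN i))) :=
    Measure.isProbabilityMeasure_map (Measurable.aemeasurable (by fun_prop))
  rw [relEntropy_eq_klDiv, relEntropy_eq_klDiv]
  clear this hN
  induction N, hkN using Nat.le_induction with
  | base => simp
  | succ n hkn ih =>
    have hP : IsExchangeable P := hexch
    refine le_trans (le_of_eq ?_)
      ((ih (initLaw P) hP.isExchangeable_initLaw).trans (hP.klDiv_initLaw_div_le ν))
    rw [initLaw, Measure.map_map (by fun_prop) (by fun_prop)]
    rfl
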